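/- Let 1 ≤ p < ∞ and 0 < q, r < ∞ with p ≤ r and p ≤ q, and let u, v, w be weights on (a,b). Then there exists a finite constant C > 0 such that the inequality (∫_a^b (∫_a^x (∫_a^t f(s) ds)^q u(t) dt)^{r/q} w(x) dx)^{1/r} ≤ C (∫_a^b f(x)^p v(x) dx)^{1/p} holds for all f ∈ 𝔐⁺(a,b) if and only if C₁ := ess sup_{x∈(a,b)} (∫_x^b w(t) (∫_x^t u)^{r/q} dt)^{1/r} · V_p(a,x) < ∞. Moreover, the best constant C in the inequality satisfies C ≈ C₁. -/

import Mathlib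

open MeasureTheory Set ENNReal

noncomputable section

/-- The open interval `(a, b)` with extended-real endpoints, viewed as a set of reals. -/
def io (a b : EReal) : Set ℝ := {x : ℝ | a < (x : EReal) ∧ (x : EReal) < b}

/-- A weight on `(a, b)`: a measurable function which is positive and finite on `(a, b)`. -/
def IsWeight (a b : EReal) (u : ℝ → ℝ≥0∞) : Prop :=
  Measurable u ∧ ∀ x ∈ io a b, 0 < u x ∧ u x < ⊤

/-- `V_p(x, y)` from the paper. -/
def Vp (p : ℝ) (v : ℝ → ℝ≥0∞) (x y : EReal) : ℝ≥0∞ :=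
  if p = 1 then essSup (fun s => (v s)⁻¹) (volume.restrict (io x y))
  else (∫⁻ s in io x y, v s ^ (-(1 / (p - 1)))) ^ ((p - 1) / p)

/-- The left-hand side of the iterated Hardy inequality. -/
def lhsIter (a b : EReal) (q r : ℝ) (u w f : ℝ → ℝ≥0∞) : ℝ≥0∞ :=
  (∫⁻ x in io a b,
    (∫⁻ t in io a x, (∫⁻ s in io a t, f s) ^ q * u t) ^ (r / q) * w x) ^ (1 / r)

/-- The right-hand side (without the constant) of the iterated Hardy inequality. -/
def rhsNorm (a b : EReal) (p : ℝ) (v f : ℝ → ℝ≥0∞) : ℝ≥0∞ :=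
  (∫⁻ x in io a b, f x ^ p * v x) ^ (1 / p)

/-- The best constant in the iterated Hardy inequality. -/
def bestIter (a b : EReal) (p q r : ℝ) (u v w : ℝ → ℝ≥0∞) : ℝ≥0∞ :=
  sInf {C : ℝ≥0∞ | ∀ f : ℝ → ℝ≥0∞, Measurable f →
    lhsIter a b q r u w f ≤ C * rhsNorm a b p v f}

/-- The constant `C₁`. -/
def C1 (a b : EReal) (p q r : ℝ) (u v w : ℝ → ℝ≥0∞) : ℝ≥0∞ :=
  essSup (fun x : ℝ =>
      (∫⁻ t in io x b, w t * (∫⁻ s in io x t, u s) ^ (r / q)) ^ (1 / r) * Vp p v a x)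
    (volume.restrict (io a b))

theorem isOpen_io (a b : EReal) : IsOpen (io a b) :=
  (isOpen_Ioo (a := a) (b := b)).preimage continuous_coe_real_ereal

theorem measurableSet_io (a b : EReal) : MeasurableSet (io a b) :=
  (isOpen_io a b).measurableSet

theorem io_mono_right (a : EReal) {b c : EReal} (h : b ≤ c) : io a b ⊆ io a c :=
  fun _ hx => ⟨hx.1, hx.2.trans_le h⟩

theorem volume_io_pos {a b : EReal} (h : a < b) : 0 < volume (io a b) := by
  obtain ⟨x, hx⟩ := EReal.lt_iff_exists_real_btwn.1 h
  exact (isOpen_io a b).measure_pos volume ⟨x, hx⟩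

theorem setLIntegral_io_pos {a b : EReal} (h : a < b) {f : ℝ → ℝ≥0∞}
    (hf : Measurable f) (hpos : ∀ x ∈ io a b, f x ≠ 0) : 0 < ∫⁻ x in io a b, f x := by
  have : Function.support f ∩ io a b = io a b := inter_eq_right.2 hpos
  rw [setLIntegral_pos_iff hf, this]
  exact volume_io_pos h

theorem measurable_setLIntegral_io (a : EReal) (f : ℝ → ℝ≥0∞) :
    Measurable fun x : ℝ => ∫⁻ t in io a x, f t :=
  Monotone.measurable fun _ _ h =>
    lintegral_mono_set (io_mono_right a (EReal.coe_le_coe_iff.2 h))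

theorem exists_countable_Ioi_cover (S : Set ℝ) :
    ∃ T ⊆ S, T.Countable ∧ ∀ᵐ x, x ∈ S → ∃ z ∈ T, z < x := by
  obtain ⟨T, hTS, hT, hU⟩ :=
    TopologicalSpace.isOpen_biUnion_countable S (fun z => Ioi z) fun _ _ => isOpen_Ioi
  refine ⟨T, hTS, hT, ?_⟩
  rw [ae_iff]
  refine Set.Subsingleton.measure_zero (fun x hx y hy => ?_) _
  have key : ∀ x, ¬(x ∈ S → ∃ z ∈ T, z < x) → x ∈ S ∧ ∀ z ∈ S, x ≤ z := by
    intro x hx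
    push Not at hx
    refine ⟨hx.1, fun z hz => ?_⟩
    by_contra! hzx
    have : x ∈ ⋃ i ∈ T, Ioi i := hU ▸ mem_biUnion hz hzx
    obtain ⟨i, hi, hix⟩ := mem_iUnion₂.1 this
    exact (hx.2 i hi).not_gt hix
  exact le_antisymm ((key x hx).2 y (key y hy).1) ((key y hy).2 x (key x hx).1)

theorem exists_countable_Iio_cover (S : Set ℝ) :
    ∃ T ⊆ S, T.Countable ∧ ∀ᵐ x, x ∈ S → ∃ z ∈ T, x < z := by
  obtain ⟨T, hTS, hT, hU⟩ :=
    TopologicalSpace.isOpen_biUnion_countable S (fun z => Iio z) fun _ _ => isOpen_Iio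
  refine ⟨T, hTS, hT, ?_⟩
  rw [ae_iff]
  refine Set.Subsingleton.measure_zero (fun x hx y hy => ?_) _
  have key : ∀ x, ¬(x ∈ S → ∃ z ∈ T, x < z) → x ∈ S ∧ ∀ z ∈ S, z ≤ x := by
    intro x hx
    push Not at hx
    refine ⟨hx.1, fun z hz => ?_⟩
    by_contra! hzx
    have : x ∈ ⋃ i ∈ T, Iio i := hU ▸ mem_biUnion hz hzx
    obtain ⟨i, hi, hix⟩ := mem_iUnion₂.1 this
    exact (hx.2 i hi).not_gt hix
  exact le_antisymm ((key y hy).2 x (key x hx).1) ((key x hx).2 y (key y hy).1)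

/-- An integral over a set of reals is controlled by the integrals over its initial pieces. -/
theorem setLIntegral_le_of_forall_Iio {S : Set ℝ} {f : ℝ → ℝ≥0∞} {c : ℝ≥0∞}
    (h : ∀ t ∈ S, ∫⁻ s in S ∩ Iio t, f s ≤ c) : ∫⁻ s in S, f s ≤ c := by
  obtain ⟨T, hTS, hT, hcov⟩ := exists_countable_Iio_cover S
  have : Countable T := hT.to_subtype
  have hle : S ≤ᵐ[volume] ⋃ z : T, S ∩ Iio (z : ℝ) := by
    filter_upwards [hcov] with x hx hxS
    obtain ⟨z, hz, hxz⟩ := hx hxS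
    exact mem_iUnion.2 ⟨⟨z, hz⟩, hxS, hxz⟩
  refine (lintegral_mono_set' hle).trans ?_
  rw [setLIntegral_iUnion_of_directed]
  · exact iSup_le fun z => h z (hTS z.2)
  · exact Monotone.directed_le (f := fun z : T => S ∩ Iio (z : ℝ))
      fun x y hxy => inter_subset_inter_right S (Iio_subset_Iio hxy)

theorem iSup_rpow {ι : Sort*} (f : ι → ℝ≥0∞) {y : ℝ} (hy : 0 < y) :
    (⨆ i, f i) ^ y = ⨆ i, f i ^ y :=
  (ENNReal.orderIsoRpow y hy).map_iSup f

/-- The iterated Lebesgue norm `‖ ‖g‖_{L^q((a, x), u)} ‖_{L^r((a, b), w)}`. -/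
def mixedNorm (a b : EReal) (q r : ℝ) (u w g : ℝ → ℝ≥0∞) : ℝ≥0∞ :=
  (∫⁻ x in io a b, (∫⁻ t in io a x, g t ^ q * u t) ^ (r / q) * w x) ^ (1 / r)

section mixedNorm

variable {a b : EReal} {q r : ℝ} {u w : ℝ → ℝ≥0∞}

theorem mixedNorm_mono_ae (hq : 0 < q) (hr : 0 < r) {g h : ℝ → ℝ≥0∞}
    (hgh : ∀ᵐ t, t ∈ io a b → g t ≤ h t) :
    mixedNorm a b q r u w g ≤ mixedNorm a b q r u w h := by
  refine ENNReal.rpow_le_rpow (setLIntegral_mono' (measurableSet_io a b) fun x hx => ?_)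
    (by positivity)
  gcongr ?_ ^ _ * _
  refine setLIntegral_mono_ae' (measurableSet_io a x) ?_
  filter_upwards [hgh] with t ht htx
  gcongr
  exact ht (io_mono_right a hx.2.le htx)

theorem mixedNorm_mono (hq : 0 < q) (hr : 0 < r) {g h : ℝ → ℝ≥0∞}
    (hgh : ∀ t ∈ io a b, g t ≤ h t) :
    mixedNorm a b q r u w g ≤ mixedNorm a b q r u w h :=
  mixedNorm_mono_ae hq hr (.of_forall hgh)

theorem mixedNorm_const_mul (hq : 0 < q) (hr : 0 < r) (hu : Measurable u) (hw : Measurable w)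
    (c : ℝ≥0∞) {g : ℝ → ℝ≥0∞} (hg : Measurable g) :
    mixedNorm a b q r u w (fun t => c * g t) = c * mixedNorm a b q r u w g := by
  have h1 : ∀ x : ℝ, (∫⁻ t in io a x, (c * g t) ^ q * u t) ^ (r / q) * w x
      = c ^ r * ((∫⁻ t in io a x, g t ^ q * u t) ^ (r / q) * w x) := by
    intro x
    simp_rw [ENNReal.mul_rpow_of_nonneg _ _ hq.le, mul_assoc]
    rw [lintegral_const_mul _ (by fun_prop), ENNReal.mul_rpow_of_nonneg _ _ (by positivity),
      ← ENNReal.rpow_mul, mul_div_cancel₀ _ hq.ne', mul_assoc]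
  have hm : Measurable fun x : ℝ => (∫⁻ t in io a x, g t ^ q * u t) ^ (r / q) * w x :=
    ((measurable_setLIntegral_io a _).pow_const _).mul hw
  unfold mixedNorm
  simp_rw [h1]
  rw [lintegral_const_mul _ hm,
    ENNReal.mul_rpow_of_nonneg _ _ (by positivity), ← ENNReal.rpow_mul, mul_one_div_cancel hr.ne',
    ENNReal.rpow_one]

theorem mixedNorm_rpow {p : ℝ} (hp : 0 < p) (g : ℝ → ℝ≥0∞) :
    mixedNorm a b (q / p) (r / p) u w (fun t => g t ^ p) = mixedNorm a b q r u w g ^ p := by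
  unfold mixedNorm
  simp_rw [← ENNReal.rpow_mul]
  rw [mul_div_cancel₀ _ hp.ne', div_div_div_cancel_right₀ hp.ne']
  congr 1
  rw [one_div_div, one_div_mul_eq_div]

theorem mixedNorm_iSup_directed {ι : Type*} [Countable ι] (hq : 0 < q) (hr : 0 < r)
    (hu : Measurable u) (hw : Measurable w) {g : ι → ℝ → ℝ≥0∞} (hg : ∀ i, Measurable (g i))
    (hd : Directed (· ≤ ·) g) :
    mixedNorm a b q r u w (fun t => ⨆ i, g i t) = ⨆ i, mixedNorm a b q r u w (g i) := by
  have h1 : ∀ x : ℝ, (∫⁻ t in io a x, (⨆ i, g i t) ^ q * u t) ^ (r / q) * w x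
      = ⨆ i, (∫⁻ t in io a x, g i t ^ q * u t) ^ (r / q) * w x := by
    intro x
    simp_rw [iSup_rpow _ hq, ENNReal.iSup_mul]
    rw [lintegral_iSup_directed, iSup_rpow _ (by positivity), ENNReal.iSup_mul]
    · exact fun i => by fun_prop
    · refine hd.mono_comp (· ≤ ·) (g := fun (h : ℝ → ℝ≥0∞) t => h t ^ q * u t) ?_
      intro h k hhk t
      have := hhk t
      dsimp only
      gcongr
  unfold mixedNorm
  simp_rw [h1]
  rw [lintegral_iSup_directed, iSup_rpow _ (by positivity)]
  · exact fun i => (((measurable_setLIntegral_io a _).pow_const _).mul hw).aemeasurable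
  · refine hd.mono_comp (· ≤ ·) (g := fun (h : ℝ → ℝ≥0∞) (x : ℝ) =>
      (∫⁻ t in io a x, h t ^ q * u t) ^ (r / q) * w x) ?_
    intro h k hhk x
    dsimp only
    gcongr with t
    exact hhk t

theorem weighted_Lp_add_le {μ : Measure ℝ} (hq : 1 ≤ q) (hu : Measurable u) {g h : ℝ → ℝ≥0∞}
    (hg : Measurable g) (hh : Measurable h) :
    (∫⁻ t, (g t + h t) ^ q * u t ∂μ) ^ (1 / q)
      ≤ (∫⁻ t, g t ^ q * u t ∂μ) ^ (1 / q) + (∫⁻ t, h t ^ q * u t ∂μ) ^ (1 / q) := by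
  have hq0 : 0 < q := by linarith
  have key : ∀ x y : ℝ≥0∞, x ^ q * y = (x * y ^ (1 / q)) ^ q := fun x y => by
    rw [ENNReal.mul_rpow_of_nonneg _ _ hq0.le, ← ENNReal.rpow_mul, one_div_mul_cancel hq0.ne',
      ENNReal.rpow_one]
  simp_rw [key, add_mul]
  exact ENNReal.lintegral_Lp_add_le (by fun_prop) (by fun_prop) hq

theorem mixedNorm_add_le (hq : 1 ≤ q) (hr : 1 ≤ r) (hu : Measurable u) (hw : Measurable w)
    {g h : ℝ → ℝ≥0∞} (hg : Measurable g) (hh : Measurable h) :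
    mixedNorm a b q r u w (fun t => g t + h t)
      ≤ mixedNorm a b q r u w g + mixedNorm a b q r u w h := by
  have hr0 : 0 < r := by linarith
  have key : ∀ y : ℝ≥0∞, y ^ (r / q) = (y ^ (1 / q)) ^ r := fun y => by
    rw [← ENNReal.rpow_mul, one_div_mul_eq_div]
  unfold mixedNorm
  simp_rw [key]
  refine le_trans ?_ (weighted_Lp_add_le hr hw ((measurable_setLIntegral_io a _).pow_const _)
    ((measurable_setLIntegral_io a _).pow_const _))
  gcongr
  exact weighted_Lp_add_le hq hu hg hh

theorem mixedNorm_sum_le {ι : Type*} (hq : 1 ≤ q) (hr : 1 ≤ r) (hu : Measurable u)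
    (hw : Measurable w) {g : ι → ℝ → ℝ≥0∞} (hg : ∀ i, Measurable (g i)) (s : Finset ι) :
    mixedNorm a b q r u w (fun t => ∑ i ∈ s, g i t) ≤ ∑ i ∈ s, mixedNorm a b q r u w (g i) := by
  classical
  induction s using Finset.induction_on with
  | empty =>
    have hq0 : 0 < q := by linarith
    have hr0 : 0 < r := by linarith
    simp [mixedNorm, ENNReal.zero_rpow_of_pos, hq0, hr0]
  | insert i s hi ih =>
    simp_rw [Finset.sum_insert hi]
    exact (mixedNorm_add_le hq hr hu hw (hg i) (by fun_prop)).trans (by gcongr)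

theorem mixedNorm_tsum_le {ι : Type*} [Countable ι] (hq : 1 ≤ q) (hr : 1 ≤ r) (hu : Measurable u)
    (hw : Measurable w) {g : ι → ℝ → ℝ≥0∞} (hg : ∀ i, Measurable (g i)) :
    mixedNorm a b q r u w (fun t => ∑' i, g i t) ≤ ∑' i, mixedNorm a b q r u w (g i) := by
  simp_rw [ENNReal.tsum_eq_iSup_sum]
  rw [mixedNorm_iSup_directed (by linarith) (by linarith) hu hw (fun s => by fun_prop)]
  · exact iSup_mono fun s => mixedNorm_sum_le hq hr hu hw hg s
  · exact Monotone.directed_le fun s s' h t => Finset.sum_le_sum_of_subset h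

theorem mixedNorm_indicator_Ioi (hq : 0 < q) (hr : 0 < r) {z : ℝ} (hz : a < z) :
    mixedNorm a b q r u w ((Ioi z).indicator 1)
      = (∫⁻ t in io z b, w t * (∫⁻ s in io z t, u s) ^ (r / q)) ^ (1 / r) := by
  have hset : ∀ c : EReal, Ioi z ∩ io a c = io z c := fun c => by
    ext t
    simp only [io, mem_inter_iff, mem_Ioi, mem_ofPred_eq, EReal.coe_lt_coe_iff]
    exact ⟨fun h => ⟨h.1, h.2.2⟩,
      fun h => ⟨h.1, hz.trans (EReal.coe_lt_coe_iff.2 h.1), h.2⟩⟩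
  have hinner : ∀ x : ℝ, ∫⁻ t in io a x, (Ioi z).indicator 1 t ^ q * u t
      = ∫⁻ t in io z x, u t := by
    intro x
    rw [← hset, ← setLIntegral_indicator measurableSet_Ioi]
    congr with t
    by_cases ht : t ∈ Ioi z <;> simp [ht, hq]
  unfold mixedNorm
  rw [← hset b, ← setLIntegral_indicator measurableSet_Ioi]
  simp_rw [hinner]
  congr with x
  by_cases hx : x ∈ Ioi z
  · simp [hx, mul_comm]
  · have : io z x = ∅ := by
      ext t
      simp only [io, mem_ofPred_eq, EReal.coe_lt_coe_iff, mem_empty_iff_false, iff_false]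
      exact fun h => hx (h.1.trans h.2)
    simp [hx, this, hq, hr, ENNReal.zero_rpow_of_pos]

/-- The mixed norm of the indicator of a set is controlled by those of the half-lines starting
in a subset of full measure. -/
theorem mixedNorm_indicator_le_of_forall_Ioi (hq : 0 < q) (hr : 0 < r) (hu : Measurable u)
    (hw : Measurable w) {E S : Set ℝ} (hES : E ≤ᵐ[volume] S) {c : ℝ≥0∞}
    (h : ∀ z ∈ S, mixedNorm a b q r u w ((Ioi z).indicator 1) ≤ c) :
    mixedNorm a b q r u w (E.indicator 1) ≤ c := by
  obtain ⟨T, hTS, hT, hcov⟩ := exists_countable_Ioi_cover S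
  have : Countable T := hT.to_subtype
  calc mixedNorm a b q r u w (E.indicator 1)
      ≤ mixedNorm a b q r u w (fun t => ⨆ z : T, (Ioi (z : ℝ)).indicator 1 t) := by
        refine mixedNorm_mono_ae hq hr ?_
        filter_upwards [hES, hcov] with t htE ht _
        by_cases htS : t ∈ E
        · obtain ⟨z, hz, hzt⟩ := ht (htE htS)
          exact le_iSup_of_le ⟨z, hz⟩ (by simp [htS, hzt])
        · simp [htS]
    _ = ⨆ z : T, mixedNorm a b q r u w ((Ioi (z : ℝ)).indicator 1) := by
        refine mixedNorm_iSup_directed hq hr hu hw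
          (fun z => measurable_one.indicator measurableSet_Ioi) ?_
        exact Antitone.directed_le fun x y hxy =>
          indicator_le_indicator_of_subset (Ioi_subset_Ioi hxy) fun _ => zero_le
    _ ≤ c := iSup_le fun z => h z (hTS z.2)

end mixedNorm

theorem Vp_mono {p : ℝ} (hp : 1 ≤ p) (v : ℝ → ℝ≥0∞) (a : EReal) {x y : EReal} (h : x ≤ y) :
    Vp p v a x ≤ Vp p v a y := by
  have hsub := io_mono_right a h
  unfold Vp
  split_ifs with h1
  · exact essSup_mono_measure (Measure.restrict_mono_set volume hsub).absolutelyContinuous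
  · exact ENNReal.rpow_le_rpow (lintegral_mono_set hsub)
      (div_nonneg (by linarith) (by linarith))

theorem Vp_pos {p : ℝ} (hp : 1 ≤ p) {v : ℝ → ℝ≥0∞} (hvm : Measurable v) {a x : EReal}
    (hax : a < x) (hv : ∀ s ∈ io a x, 0 < v s ∧ v s < ⊤) : 0 < Vp p v a x := by
  unfold Vp
  split_ifs with h1
  · rw [pos_iff_ne_zero, Ne, ENNReal.essSup_eq_zero_iff, Filter.EventuallyEq,
      ae_restrict_iff' (measurableSet_io a x)]
    intro h
    have h0 : volume (io a x) = 0 := by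
      refine measure_mono_null (t := {s | s ∈ io a x → (v s)⁻¹ = 0}ᶜ) (fun s hs hs' => ?_) h
      exact (hv s hs).2.ne (ENNReal.inv_eq_zero.1 (hs' hs))
    exact (volume_io_pos hax).ne' h0
  · refine ENNReal.rpow_pos_of_nonneg (setLIntegral_io_pos hax (by fun_prop) fun s hs => ?_)
      (div_nonneg (by linarith) (by linarith))
    have := hv s hs
    simp [ENNReal.rpow_eq_zero_iff, this.1.ne', this.2.ne]

theorem setLIntegral_le_mul_Vp {p : ℝ} (hp : 1 ≤ p) {v f : ℝ → ℝ≥0∞} (hvm : Measurable v)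
    (hf : Measurable f) {a x : EReal} (hv : ∀ s ∈ io a x, 0 < v s ∧ v s < ⊤) {A : Set ℝ}
    (hA : MeasurableSet A) (hAx : A ⊆ io a x) :
    ∫⁻ s in A, f s ≤ (∫⁻ s in A, f s ^ p * v s) ^ (1 / p) * Vp p v a x := by
  have hp0 : 0 < p := by linarith
  rcases eq_or_ne p 1 with rfl | h1
  · simp only [Vp, if_true, ENNReal.rpow_one, div_one]
    rw [← lintegral_mul_const _ (by fun_prop)]
    refine setLIntegral_mono_ae' hA ?_
    have := ENNReal.ae_le_essSup (μ := volume.restrict (io a x)) fun s => (v s)⁻¹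
    rw [ae_restrict_iff' (measurableSet_io a x)] at this
    filter_upwards [this] with s hs hsA
    have hvs := hv s (hAx hsA)
    calc f s = f s * v s * (v s)⁻¹ := by
          rw [mul_assoc, ENNReal.mul_inv_cancel hvs.1.ne' hvs.2.ne, mul_one]
      _ ≤ _ := by gcongr; exact hs (hAx hsA)
  · have hp1 : 1 < p := lt_of_le_of_ne hp h1.symm
    have hpq := Real.HolderConjugate.conjExponent hp1
    have hq0 : 0 < p.conjExponent := hpq.symm.pos
    have key := ENNReal.lintegral_mul_le_Lp_mul_Lq (volume.restrict A) hpq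
      (f := fun s => f s * v s ^ (1 / p)) (g := fun s => v s ^ (-(1 / p)))
      (by fun_prop) (by fun_prop)
    have e1 : ∫⁻ s in A, f s
        = ∫⁻ s in A, ((fun s => f s * v s ^ (1 / p)) * fun s => v s ^ (-(1 / p))) s := by
      refine setLIntegral_congr_fun hA fun s hs => ?_
      have hvs := hv s (hAx hs)
      simp only [Pi.mul_apply]
      rw [mul_assoc, ← ENNReal.rpow_add _ _ hvs.1.ne' hvs.2.ne]
      simp
    rw [e1]
    refine key.trans ?_
    simp_rw [ENNReal.mul_rpow_of_nonneg _ _ hp0.le, ← ENNReal.rpow_mul,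
      one_div_mul_cancel hp0.ne', ENNReal.rpow_one]
    rw [Vp, if_neg h1]
    have e2 : -(1 / p) * p.conjExponent = -(1 / (p - 1)) := by
      rw [Real.conjExponent]
      have : p - 1 ≠ 0 := by linarith
      field_simp
    have e3 : 1 / p.conjExponent = (p - 1) / p := by rw [Real.conjExponent, one_div_div]
    rw [e2, e3]
    gcongr

/-- The dyadic level set `{2 ^ k ≤ V_p(a, ·) < 2 ^ (k + 1)}`. -/
def levelSet (a b : EReal) (p : ℝ) (v : ℝ → ℝ≥0∞) (k : ℤ) : Set ℝ :=
  {t ∈ io a b | Vp p v a t ∈ Ico ((2 : ℝ≥0∞) ^ k) (2 ^ (k + 1))}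

section levelSet

variable {a b : EReal} {p : ℝ} {v : ℝ → ℝ≥0∞}

theorem measurableSet_levelSet (hp : 1 ≤ p) (k : ℤ) : MeasurableSet (levelSet a b p v k) := by
  have hm : Measurable fun t : ℝ => Vp p v a t :=
    Monotone.measurable fun _ _ h => Vp_mono hp v a (EReal.coe_le_coe_iff.2 h)
  exact (measurableSet_io a b).inter (hm measurableSet_Ico)

theorem le_of_zpow_le_of_lt_zpow {x y : ℝ≥0∞} (hxy : x ≤ y) {j k : ℤ}
    (hj : (2 : ℝ≥0∞) ^ j ≤ x) (hk : y < 2 ^ (k + 1)) : j ≤ k := by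
  by_contra! h
  have : (2 : ℝ≥0∞) ^ (k + 1) ≤ 2 ^ j := ENNReal.zpow_le_of_le one_le_two h
  exact ((hxy.trans_lt hk).trans_le (this.trans hj)).false

theorem pairwise_disjoint_levelSet :
    Pairwise (Function.onFun Disjoint (levelSet a b p v)) := by
  intro j k hjk
  refine disjoint_left.2 fun t hj hk => hjk (le_antisymm ?_ ?_)
  · exact le_of_zpow_le_of_lt_zpow le_rfl hj.2.1 hk.2.2
  · exact le_of_zpow_le_of_lt_zpow le_rfl hk.2.1 hj.2.2

theorem setLIntegral_levelSet_le (hp : 1 ≤ p) (hv : IsWeight a b v) {f : ℝ → ℝ≥0∞}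
    (hf : Measurable f) (k : ℤ) :
    ∫⁻ s in levelSet a b p v k, f s
      ≤ (∫⁻ s in levelSet a b p v k, f s ^ p * v s) ^ (1 / p) * 2 ^ (k + 1) := by
  refine setLIntegral_le_of_forall_Iio fun t ht => ?_
  have hsub : io a t ⊆ io a b := io_mono_right a ht.1.2.le
  refine (setLIntegral_le_mul_Vp hp hv.1 hf (fun s hs => hv.2 s (hsub hs))
    ((measurableSet_levelSet hp k).inter measurableSet_Iio)
    fun s hs => ⟨hs.1.1.1, EReal.coe_lt_coe_iff.2 hs.2⟩).trans ?_
  gcongr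
  · exact inter_subset_left
  · exact ht.2.2.le

theorem setLIntegral_io_le_tsum_levelSet (hp : 1 ≤ p) (hv : IsWeight a b v) (f : ℝ → ℝ≥0∞)
    {k : ℤ} {t : ℝ} (ht : t ∈ levelSet a b p v k) :
    ∫⁻ s in io a t, f s ≤ ∑' m : ℕ, ∫⁻ s in levelSet a b p v (k - m), f s := by
  refine (lintegral_mono_set fun s hs => ?_).trans (lintegral_iUnion_le _ f)
  have hst : Vp p v a s ≤ Vp p v a t := Vp_mono hp v a hs.2.le
  have hsb : s ∈ io a b := io_mono_right a ht.1.2.le hs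
  have hpos : 0 < Vp p v a s :=
    Vp_pos hp hv.1 hs.1 fun y hy => hv.2 y (io_mono_right a hsb.2.le hy)
  obtain ⟨j, hj⟩ := ENNReal.exists_mem_Ico_zpow hpos.ne'
    (hst.trans_lt (ht.2.2.trans_le le_top)).ne (one_lt_two : (1 : ℝ≥0∞) < 2) ENNReal.ofNat_ne_top
  have hjk : j ≤ k := le_of_zpow_le_of_lt_zpow hst hj.1 ht.2.2
  refine mem_iUnion.2 ⟨(k - j).toNat, ?_⟩
  rw [Int.toNat_of_nonneg (by lia), _root_.sub_sub_cancel]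
  exact ⟨hsb, hj⟩

theorem tsum_setLIntegral_levelSet_sub_le (hp : 1 ≤ p) (f : ℝ → ℝ≥0∞) (m : ℤ) :
    ∑' k : ℤ, ∫⁻ s in levelSet a b p v (k - m), f s ≤ ∫⁻ s in io a b, f s := by
  have hshift : ∑' k : ℤ, ∫⁻ s in levelSet a b p v (k - m), f s
      = ∑' k : ℤ, ∫⁻ s in levelSet a b p v k, f s :=
    (Equiv.subRight m).tsum_eq fun k : ℤ => ∫⁻ s in levelSet a b p v k, f s
  rw [hshift,
    ← lintegral_iUnion (fun k => measurableSet_levelSet hp k) pairwise_disjoint_levelSet]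
  exact lintegral_mono_set (iUnion_subset fun k => sep_subset _ _)

end levelSet

section

variable {a b : EReal} {p q r : ℝ} {u v w : ℝ → ℝ≥0∞}

theorem mixedNorm_levelSet_le (hq : 0 < q) (hr : 0 < r) (hu : Measurable u) (hw : Measurable w)
    (k : ℤ) :
    2 ^ k * mixedNorm a b q r u w ((levelSet a b p v k).indicator 1) ≤ C1 a b p q r u v w := by
  have h2 : (2 : ℝ≥0∞) ^ k ≠ 0 := (ENNReal.zpow_pos two_ne_zero ENNReal.ofNat_ne_top k).ne'
  have h2' : (2 : ℝ≥0∞) ^ k ≠ ⊤ := ENNReal.zpow_ne_top two_ne_zero ENNReal.ofNat_ne_top k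
  rw [mul_comm, ← ENNReal.le_div_iff_mul_le (.inl h2) (.inl h2')]
  have hae := ENNReal.ae_le_essSup (μ := volume.restrict (io a b)) fun x : ℝ =>
      (∫⁻ t in io x b, w t * (∫⁻ s in io x t, u s) ^ (r / q)) ^ (1 / r) * Vp p v a x
  rw [ae_restrict_iff' (measurableSet_io a b)] at hae
  refine mixedNorm_indicator_le_of_forall_Ioi hq hr hu hw
    (S := {z ∈ levelSet a b p v k |
      (∫⁻ t in io z b, w t * (∫⁻ s in io z t, u s) ^ (r / q)) ^ (1 / r) * Vp p v a z
        ≤ C1 a b p q r u v w}) ?_ fun z hz => ?_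
  · filter_upwards [hae] with z hz hzk
    exact ⟨hzk, hz hzk.1⟩
  · rw [mixedNorm_indicator_Ioi hq hr hz.1.1.1, ENNReal.le_div_iff_mul_le (.inl h2) (.inl h2')]
    refine le_trans ?_ hz.2
    gcongr
    exact hz.1.2.1

theorem mixedNorm_tsum_levelSet_rpow_le (hp : 1 ≤ p) (hpr : p ≤ r) (hpq : p ≤ q)
    (hu : Measurable u) (hw : Measurable w) (c : ℤ → ℝ≥0∞) :
    mixedNorm a b q r u w (fun t => ∑' k, (levelSet a b p v k).indicator (fun _ => c k) t) ^ p
      ≤ ∑' k, (c k * mixedNorm a b q r u w ((levelSet a b p v k).indicator 1)) ^ p := by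
  have hp0 : 0 < p := by linarith
  have hq : 0 < q := by linarith
  have hr : 0 < r := by linarith
  have hE := fun k => measurableSet_levelSet (a := a) (b := b) (v := v) hp k
  have hind : ∀ k, Measurable ((levelSet a b p v k).indicator (1 : ℝ → ℝ≥0∞)) :=
    fun k => measurable_one.indicator (hE k)
  have hpt : ∀ t, (∑' k, (levelSet a b p v k).indicator (fun _ => c k) t) ^ p
      = ∑' k, c k ^ p * (levelSet a b p v k).indicator 1 t := by
    intro t
    by_cases ht : ∃ k, t ∈ levelSet a b p v k
    · obtain ⟨k, hk⟩ := ht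
      have hne : ∀ j ≠ k, t ∉ levelSet a b p v j := fun j hj h =>
        disjoint_left.1 (pairwise_disjoint_levelSet hj) h hk
      rw [tsum_eq_single k fun j hj => by simp [hne j hj],
        tsum_eq_single k fun j hj => by simp [hne j hj]]
      simp [hk]
    · push Not at ht
      simp [ht, hp0]
  rw [← mixedNorm_rpow hp0]
  simp_rw [hpt]
  refine (mixedNorm_tsum_le ((one_le_div hp0).2 hpq) ((one_le_div hp0).2 hpr) hu hw
    fun k => (hind k).const_mul _).trans (le_of_eq ?_)
  congr with k
  rw [mixedNorm_const_mul (by positivity) (by positivity) hu hw _ (hind k),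
    ENNReal.mul_rpow_of_nonneg _ _ hp0.le, ← mixedNorm_rpow hp0]
  congr 2 with t
  by_cases ht : t ∈ levelSet a b p v k <;> simp [ht, hp0]

theorem lhsIter_le (hp : 1 ≤ p) (hpr : p ≤ r) (hpq : p ≤ q) (hu : Measurable u)
    (hv : IsWeight a b v) (hw : Measurable w)
    (hfin : ∀ᵐ t : ℝ, t ∈ io a b → Vp p v a t < ⊤) {f : ℝ → ℝ≥0∞} (hf : Measurable f) :
    lhsIter a b q r u w f ≤ 4 * C1 a b p q r u v w * rhsNorm a b p v f := by
  have hp0 : 0 < p := by linarith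
  have hq : 0 < q := by linarith
  have hr : 0 < r := by linarith
  set E := levelSet a b p v
  set A : ℤ → ℝ≥0∞ := fun k => (∫⁻ s in E k, f s ^ p * v s) ^ (1 / p)
  set g : ℕ → ℝ → ℝ≥0∞ := fun m t =>
    ∑' k, (E k).indicator (fun _ => A (k - m) * 2 ^ (k - m + 1)) t
  have hE : ∀ k, MeasurableSet (E k) := measurableSet_levelSet hp
  have hg : ∀ m, Measurable (g m) := fun m =>
    Measurable.tsum fun k => measurable_const.indicator (hE k)
  have hpt : ∀ᵐ t : ℝ, t ∈ io a b → ∫⁻ s in io a t, f s ≤ ∑' m, g m t := by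
    filter_upwards [hfin] with t ht htab
    have hpos : 0 < Vp p v a t :=
      Vp_pos hp hv.1 htab.1 fun y hy => hv.2 y (io_mono_right a htab.2.le hy)
    obtain ⟨k, hk⟩ := ENNReal.exists_mem_Ico_zpow hpos.ne' (ht htab).ne
      (one_lt_two : (1 : ℝ≥0∞) < 2) ENNReal.ofNat_ne_top
    have htk : t ∈ E k := ⟨htab, hk⟩
    refine (setLIntegral_io_le_tsum_levelSet hp hv f htk).trans (ENNReal.tsum_le_tsum fun m => ?_)
    refine (setLIntegral_levelSet_le hp hv hf _).trans ?_
    refine le_trans (le_of_eq ?_) (ENNReal.le_tsum k)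
    simp [htk, A, E]
  have hgm : ∀ m : ℕ, mixedNorm a b q r u w (g m)
      ≤ 2⁻¹ ^ m * (2 * C1 a b p q r u v w * rhsNorm a b p v f) := by
    intro m
    rw [← ENNReal.rpow_le_rpow_iff hp0]
    calc mixedNorm a b q r u w (g m) ^ p
        ≤ ∑' k, (A (k - m) * 2 ^ (k - m + 1)
            * mixedNorm a b q r u w ((E k).indicator 1)) ^ p :=
          mixedNorm_tsum_levelSet_rpow_le hp hpr hpq hu hw _
      _ ≤ ∑' k : ℤ, (2⁻¹ ^ m * (2 * C1 a b p q r u v w)) ^ p * A (k - m) ^ p := by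
          refine ENNReal.tsum_le_tsum fun k => ?_
          rw [← ENNReal.mul_rpow_of_nonneg _ _ hp0.le]
          refine ENNReal.rpow_le_rpow ?_ hp0.le
          have h2 : (2 : ℝ≥0∞) ^ (k - m + 1) = 2⁻¹ ^ m * 2 * 2 ^ k := by
            rw [ENNReal.zpow_add two_ne_zero ENNReal.ofNat_ne_top,
              ENNReal.zpow_sub two_ne_zero ENNReal.ofNat_ne_top, zpow_natCast, zpow_one,
              ENNReal.inv_pow]
            ring
          calc A (k - m) * 2 ^ (k - m + 1) * mixedNorm a b q r u w ((E k).indicator 1)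
              = 2⁻¹ ^ m * 2 * (2 ^ k * mixedNorm a b q r u w ((E k).indicator 1))
                * A (k - m) := by rw [h2]; ring
            _ ≤ 2⁻¹ ^ m * 2 * C1 a b p q r u v w * A (k - m) := by
                gcongr
                exact mixedNorm_levelSet_le hq hr hu hw k
            _ = _ := by ring
      _ = (2⁻¹ ^ m * (2 * C1 a b p q r u v w)) ^ p
            * ∑' k : ℤ, ∫⁻ s in E (k - m), f s ^ p * v s := by
          rw [ENNReal.tsum_mul_left]
          congr with k
          rw [← ENNReal.rpow_mul, one_div_mul_cancel hp0.ne', ENNReal.rpow_one]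
      _ ≤ (2⁻¹ ^ m * (2 * C1 a b p q r u v w)) ^ p * ∫⁻ s in io a b, f s ^ p * v s := by
          gcongr
          exact tsum_setLIntegral_levelSet_sub_le hp _ _
      _ = (2⁻¹ ^ m * (2 * C1 a b p q r u v w * rhsNorm a b p v f)) ^ p := by
          rw [← mul_assoc _ _ (rhsNorm a b p v f),
            ENNReal.mul_rpow_of_nonneg _ (rhsNorm a b p v f) hp0.le, rhsNorm,
            ← ENNReal.rpow_mul, one_div_mul_cancel hp0.ne', ENNReal.rpow_one]
  calc lhsIter a b q r u w f
      ≤ mixedNorm a b q r u w (fun t => ∑' m, g m t) := mixedNorm_mono_ae hq hr hpt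
    _ ≤ ∑' m, mixedNorm a b q r u w (g m) :=
        mixedNorm_tsum_le (hp.trans hpq) (hp.trans hpr) hu hw hg
    _ ≤ ∑' m : ℕ, 2⁻¹ ^ m * (2 * C1 a b p q r u v w * rhsNorm a b p v f) :=
        ENNReal.tsum_le_tsum hgm
    _ = 4 * C1 a b p q r u v w * rhsNorm a b p v f := by
        rw [ENNReal.tsum_mul_right, ENNReal.tsum_geometric_two]
        ring

theorem ae_Vp_lt_top (hq : 0 < q) (hr : 0 < r) (hu : IsWeight a b u) (hw : IsWeight a b w)
    (hC : C1 a b p q r u v w < ⊤) : ∀ᵐ t : ℝ, t ∈ io a b → Vp p v a t < ⊤ := by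
  have hae := ENNReal.ae_le_essSup (μ := volume.restrict (io a b)) fun x : ℝ =>
      (∫⁻ t in io x b, w t * (∫⁻ s in io x t, u s) ^ (r / q)) ^ (1 / r) * Vp p v a x
  rw [ae_restrict_iff' (measurableSet_io a b)] at hae
  filter_upwards [hae] with x hx hxab
  have hlt := (hx hxab).trans_lt hC
  rw [lt_top_iff_ne_top]
  intro htop
  rw [htop, ENNReal.mul_top] at hlt
  · exact hlt.false
  refine (ENNReal.rpow_pos_of_nonneg (setLIntegral_io_pos hxab.2
    (hw.1.mul ((measurable_setLIntegral_io x u).pow_const _)) fun t ht => ?_) (by positivity)).ne'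
  have htab : t ∈ io a b := ⟨hxab.1.trans ht.1, ht.2⟩
  refine mul_ne_zero (hw.2 t htab).1.ne' (ENNReal.rpow_pos_of_nonneg
    (setLIntegral_io_pos ht.1 hu.1 fun s hs => ?_) (by positivity)).ne'
  exact (hu.2 s ⟨hxab.1.trans hs.1, hs.2.trans htab.2⟩).1.ne'

theorem mul_setLIntegral_le_lhsIter (hq : 0 < q) (hr : 0 < r) (hu : Measurable u)
    (hw : Measurable w) {x : ℝ} (hx : a < x) (f : ℝ → ℝ≥0∞) :
    (∫⁻ t in io x b, w t * (∫⁻ s in io x t, u s) ^ (r / q)) ^ (1 / r) * ∫⁻ s in io a x, f s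
      ≤ lhsIter a b q r u w f := by
  rw [← mixedNorm_indicator_Ioi hq hr hx, mul_comm,
    ← mixedNorm_const_mul hq hr hu hw _ (measurable_one.indicator measurableSet_Ioi)]
  refine mixedNorm_mono hq hr fun t _ => ?_
  by_cases ht : t ∈ Ioi x
  · simpa [ht] using lintegral_mono_set (io_mono_right a (EReal.coe_le_coe_iff.2 (le_of_lt ht)))
  · simp [ht]

theorem rhsNorm_indicator (hp : 0 < p) {S : Set ℝ} (hS : MeasurableSet S) (hSab : S ⊆ io a b)
    (f : ℝ → ℝ≥0∞) :
    rhsNorm a b p v (S.indicator f) = (∫⁻ s in S, f s ^ p * v s) ^ (1 / p) := by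
  have hpt : ∀ s, S.indicator f s ^ p * v s = S.indicator (fun s => f s ^ p * v s) s := by
    intro s
    by_cases hs : s ∈ S <;> simp [hs, hp]
  simp_rw [rhsNorm, hpt]
  rw [setLIntegral_indicator hS, inter_eq_left.2 hSab]

/-- The converse of Hölder's inequality identifying `V_p(a, x)`. -/
theorem mul_Vp_le_of_forall (hp : 1 ≤ p) (hv : IsWeight a b v) {x : ℝ} (hx : x ∈ io a b)
    {G C : ℝ≥0∞} (h : ∀ f : ℝ → ℝ≥0∞, Measurable f →
      G * ∫⁻ s in io a x, f s ≤ C * rhsNorm a b p v f) : G * Vp p v a x ≤ C := by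
  have hp0 : 0 < p := by linarith
  have hvm := hv.1
  have hsub : io a x ⊆ io a b := io_mono_right a hx.2.le
  have htest : ∀ S ⊆ io a x, MeasurableSet S → ∀ f : ℝ → ℝ≥0∞, Measurable f →
      G * ∫⁻ s in S, f s ≤ C * (∫⁻ s in S, f s ^ p * v s) ^ (1 / p) := by
    intro S hSx hS f hf
    have := h _ (hf.indicator hS)
    rwa [rhsNorm_indicator hp0 hS (hSx.trans hsub), setLIntegral_indicator hS,
      inter_eq_left.2 hSx] at this
  rcases eq_or_ne p 1 with rfl | h1
  · refine ENNReal.mul_le_of_forall_lt fun G' hG' l hl => ?_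
    rcases eq_or_ne l 0 with rfl | hl0
    · simp
    have hltop : l ≠ ⊤ := hl.ne_top
    set S := {s ∈ io a x | l < (v s)⁻¹}
    have hS : MeasurableSet S :=
      (measurableSet_io a x).inter (measurableSet_lt measurable_const hvm.inv)
    have hS0 : 0 < volume S := by
      rw [pos_iff_ne_zero]
      intro h0
      refine hl.not_ge ?_
      rw [Vp, if_pos rfl]
      refine essSup_le_of_ae_le _ ?_
      rw [Filter.EventuallyLE, ae_restrict_iff' (measurableSet_io a x)]
      refine measure_mono_null (fun s hs => ?_) h0
      simpa [S] using hs
    obtain ⟨T, hT, hTS, hT0, hTtop⟩ := Measure.exists_subset_measure_lt_top hS hS0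
    have key := htest T (hTS.trans (sep_subset _ _)) hT 1 measurable_one
    have hint : ∫⁻ s in T, (1 : ℝ → ℝ≥0∞) s ^ (1 : ℝ) * v s ≤ l⁻¹ * volume T := by
      rw [← setLIntegral_const]
      refine setLIntegral_mono' hT fun s hs => ?_
      simpa using (ENNReal.le_inv_iff_le_inv.1 (hTS hs).2.le)
    have key2 : G * volume T ≤ C * l⁻¹ * volume T := by
      calc G * volume T ≤ C * (l⁻¹ * volume T) := by
            simp only [Pi.one_apply, lintegral_one, Measure.restrict_apply_univ, div_one,
              ENNReal.rpow_one] at key hint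
            exact key.trans (by gcongr)
        _ = _ := by ring
    have hGC : G ≤ C / l := (ENNReal.mul_le_mul_iff_left hT0.ne' hTtop.ne).1 key2
    exact (mul_le_mul_left hG'.le l).trans (ENNReal.mul_le_of_le_div hGC)
  · have hp1 : 1 < p := lt_of_le_of_ne hp h1.symm
    set φ : ℝ → ℝ≥0∞ := fun s => v s ^ (-(1 / (p - 1)))
    have hφm : Measurable φ := by fun_prop
    set S : ℕ → Set ℝ := fun n => {s ∈ io a x | φ s ≤ n ∧ s ∈ Ioo (-n : ℝ) n}
    have hS : ∀ n, MeasurableSet (S n) := fun n =>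
      (measurableSet_io a x).inter
        ((measurableSet_le hφm measurable_const).inter measurableSet_Ioo)
    have hSmono : Monotone S := fun m n hmn s hs => by
      have hmn' : (m : ℝ) ≤ n := by exact_mod_cast hmn
      refine ⟨hs.1, hs.2.1.trans (by exact_mod_cast hmn), ?_, hs.2.2.2.trans_le hmn'⟩
      exact lt_of_le_of_lt (neg_le_neg hmn') hs.2.2.1
    have hUnion : ⋃ n, S n = io a x := by
      refine Subset.antisymm (iUnion_subset fun n => sep_subset _ _) fun s hs => ?_
      have hvs := hv.2 s (hsub hs)
      have hφ : φ s ≠ ⊤ := ENNReal.rpow_ne_top_of_ne_zero hvs.1.ne' hvs.2.ne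
      obtain ⟨n, hn⟩ := ENNReal.exists_nat_gt hφ
      obtain ⟨m, hm⟩ := exists_nat_gt |s|
      have hm' : |s| < (max n m : ℕ) := hm.trans_le (by exact_mod_cast le_max_right n m)
      refine mem_iUnion.2 ⟨max n m, hs, hn.le.trans ?_, abs_lt.1 hm'⟩
      exact_mod_cast le_max_left n m
    rw [Vp, if_neg h1, ← hUnion, setLIntegral_iUnion_of_directed _ hSmono.directed_le,
      iSup_rpow _ (div_pos (by linarith) hp0), ENNReal.mul_iSup]
    refine iSup_le fun n => ?_
    set I := ∫⁻ s in S n, φ s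
    have hI : I ≠ ⊤ := by
      refine ne_top_of_le_ne_top ?_ (setLIntegral_mono' (g := fun _ => (n : ℝ≥0∞)) (hS n)
        fun s hs => hs.2.1)
      rw [setLIntegral_const]
      refine ENNReal.mul_ne_top (by simp) (ne_top_of_le_ne_top ?_
        (measure_mono (t := Ioo (-n : ℝ) n) fun s hs => hs.2.2))
      simp
    rcases eq_or_ne I 0 with hI0 | hI0
    · simp [hI0, div_pos (sub_pos.2 hp1) hp0]
    have key := htest (S n) (sep_subset _ _) (hS n) φ hφm
    have hint : ∫⁻ s in S n, φ s ^ p * v s = I := by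
      refine setLIntegral_congr_fun (hS n) fun s hs => ?_
      have hvs := hv.2 s (hsub hs.1)
      have hne : p - 1 ≠ 0 := by linarith
      simp only [φ]
      rw [← ENNReal.rpow_mul]
      nth_rewrite 2 [← ENNReal.rpow_one (v s)]
      rw [← ENNReal.rpow_add _ _ hvs.1.ne' hvs.2.ne]
      congr 1
      field_simp
      ring
    rw [hint] at key
    have hIp0 : I ^ (1 / p) ≠ 0 := by simp [ENNReal.rpow_eq_zero_iff, hI0, hI]
    have hIptop : I ^ (1 / p) ≠ ⊤ := ENNReal.rpow_ne_top_of_ne_zero hI0 hI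
    rw [← ENNReal.mul_le_mul_iff_left hIp0 hIptop, mul_assoc, ← ENNReal.rpow_add _ _ hI0 hI]
    have : (p - 1) / p + 1 / p = 1 := by field_simp; ring
    rwa [this, ENNReal.rpow_one]

theorem C1_le_of_forall (hp : 1 ≤ p) (hq : 0 < q) (hr : 0 < r) (hu : Measurable u)
    (hv : IsWeight a b v) (hw : Measurable w) {C : ℝ≥0∞}
    (h : ∀ f : ℝ → ℝ≥0∞, Measurable f → lhsIter a b q r u w f ≤ C * rhsNorm a b p v f) :
    C1 a b p q r u v w ≤ C := by
  refine essSup_le_of_ae_le _ ?_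
  rw [Filter.EventuallyLE, ae_restrict_iff' (measurableSet_io a b)]
  refine .of_forall fun x hx => mul_Vp_le_of_forall hp hv hx fun f hf => ?_
  exact (mul_setLIntegral_le_lhsIter hq hr hu hw hx.1 f).trans (h f hf)

end

theorem iterated_hardy_case_i (p q r : ℝ) (hp : 1 ≤ p) (hq : 0 < q) (hr : 0 < r)
    (hpr : p ≤ r) (hpq : p ≤ q) :
    ∃ c₁ c₂ : ℝ≥0∞, 0 < c₁ ∧ c₂ < ⊤ ∧
      ∀ (a b : EReal), a < b → ∀ u v w : ℝ → ℝ≥0∞,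
        IsWeight a b u → IsWeight a b v → IsWeight a b w →
        ((∃ C : ℝ≥0∞, 0 < C ∧ C < ⊤ ∧ ∀ f : ℝ → ℝ≥0∞, Measurable f →
            lhsIter a b q r u w f ≤ C * rhsNorm a b p v f) ↔
          C1 a b p q r u v w < ⊤) ∧
        c₁ * C1 a b p q r u v w ≤ bestIter a b p q r u v w ∧
        bestIter a b p q r u v w ≤ c₂ * C1 a b p q r u v w := by
  refine ⟨1, 4, one_pos, by simp, fun a b _ u v w hu hv hw => ⟨⟨?_, fun hC => ?_⟩, ?_, ?_⟩⟩
  · rintro ⟨C, -, hC, h⟩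
    exact (C1_le_of_forall hp hq hr hu.1 hv hw.1 h).trans_lt hC
  · refine ⟨4 * C1 a b p q r u v w + 1, by simp, by finiteness, fun f hf => ?_⟩
    refine (lhsIter_le hp hpr hpq hu.1 hv hw.1 (ae_Vp_lt_top hq hr hu hw hC) hf).trans ?_
    gcongr
    exact le_self_add
  · rw [one_mul]
    exact le_sInf fun C h => C1_le_of_forall hp hq hr hu.1 hv hw.1 h
  · rcases eq_top_or_lt_top (C1 a b p q r u v w) with hC | hC
    · simp [hC]
    · exact sInf_le fun f hf =>
        lhsIter_le hp hpr hpq hu.1 hv hw.1 (ae_Vp_lt_top hq hr hu hw hC) hf
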